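/- The graph F(8,13,8), defined as the simple graph on vertex set {1,...,8} with edge set {{1,2},{2,4},{3,4},{3,5},{1,5},{1,3},{2,3},{5,6},{6,8},{7,8},{5,7},{6,7},{4,8}}, is forbidden: there is no injective map φ : {1,...,8} → ℝ² with dist(φ(i), φ(j)) = 1 for every edge {i,j}. -/

import Mathlib

lemma sq_sum_aux {x y : ℝ} (h : x^2+y^2=0) : x = 0 ∧ y = 0 := by
  constructor
  · exact pow_eq_zero_iff (two_ne_zero) |>.mp (by linarith [sq_nonneg x, sq_nonneg y])
  · exact pow_eq_zero_iff (two_ne_zero) |>.mp (by linarith [sq_nonneg x, sq_nonneg y])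

lemma rhombus_aux {a b c d a' b' c' d' : ℝ}
    (h1 : (a-b)^2+(a'-b')^2=1) (h2 : (a-c)^2+(a'-c')^2=1) (h3 : (b-c)^2+(b'-c')^2=1)
    (h4 : (d-b)^2+(d'-b')^2=1) (h5 : (d-c)^2+(d'-c')^2=1) (hne : ¬ (a = d ∧ a' = d')) :
    d = b + c - a ∧ d' = b' + c' - a' := by
  have e1 : (d-a)*(b-c)+(d'-a')*(b'-c') = 0 := by linear_combination (h1-h2-h4+h5)/2
  have e2 : (d-a)*(d-b-c+a)+(d'-a')*(d'-b'-c'+a') = 0 := by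
    linear_combination (h4+h5-h1-h2)/2
  have e3 : (b-c)*(d-b-c+a)+(b'-c')*(d'-b'-c'+a') = 0 := by
    linear_combination e1 - h1 + h2
  have hw : (d-a)^2+(d'-a')^2 ≠ 0 := by
    intro h
    apply hne
    obtain ⟨u, v⟩ := sq_sum_aux h
    constructor <;> linarith
  have e4 : (b-c)*(d'-b'-c'+a') - (b'-c')*(d-b-c+a) = 0 := by
    have : ((d-a)^2+(d'-a')^2) * ((b-c)*(d'-b'-c'+a') - (b'-c')*(d-b-c+a)) = 0 := by
      linear_combination ((d-a)*(d'-b'-c'+a')-(d'-a')*(d-b-c+a)) * e1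
        - ((d-a)*(b'-c')-(d'-a')*(b-c)) * e2
    exact (mul_eq_zero.mp this).resolve_left hw
  constructor
  · linear_combination (b-c)*e3 - (b'-c')*e4 - (d-b-c+a)*h3
  · linear_combination (b'-c')*e3 + (b-c)*e4 - (d'-b'-c'+a')*h3

lemma final_aux {z a b z' a' b' : ℝ} (hz : z^2+z'^2=1) (ha : a^2+a'^2=1) (hb : b^2+b'^2=1)
    (hab : (a-b)^2+(a'-b')^2=1) (h : (2*z+a+b)^2+(2*z'+a'+b')^2=1) :
    (z + a = 0 ∧ z' + a' = 0) ∨ (z + b = 0 ∧ z' + b' = 0) := by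
  have G : ∀ Z A B p q r : ℝ, z^2+z'^2=Z → a^2+a'^2=A → b^2+b'^2=B → z*a+z'*a'=p →
      z*b+z'*b'=q → a*b+a'*b'=r → Z*A*B+2*p*q*r-Z*r^2-A*q^2-B*p^2=0 := by
    rintro _ _ _ _ _ _ rfl rfl rfl rfl rfl rfl
    ring
  have r : a*b+a'*b' = 1/2 := by linear_combination (ha+hb-hab)/2
  have q : z*b+z'*b' = -3/2 - (z*a+z'*a') := by
    linear_combination (h-4*hz-ha-hb-2*r)/4
  have g := G _ _ _ _ _ _ hz ha hb rfl q r
  have k : (z*a+z'*a'+1)*(z*a+z'*a'+1/2) = 0 := by linear_combination (-1/3)*g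
  rcases mul_eq_zero.mp k with k | k
  · left
    exact sq_sum_aux (by linear_combination hz+ha+2*k)
  · right
    exact sq_sum_aux (by linear_combination hz+hb+2*q-2*k)


theorem F_8_13_8_forbidden :
    ¬ ∃ φ : ℕ → EuclideanSpace ℝ (Fin 2),
      Set.InjOn φ (Set.Icc 1 8) ∧
      dist (φ 1) (φ 2) = 1 ∧
      dist (φ 2) (φ 4) = 1 ∧
      dist (φ 3) (φ 4) = 1 ∧
      dist (φ 3) (φ 5) = 1 ∧
      dist (φ 1) (φ 5) = 1 ∧
      dist (φ 1) (φ 3) = 1 ∧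
      dist (φ 2) (φ 3) = 1 ∧
      dist (φ 5) (φ 6) = 1 ∧
      dist (φ 6) (φ 8) = 1 ∧
      dist (φ 7) (φ 8) = 1 ∧
      dist (φ 5) (φ 7) = 1 ∧
      dist (φ 6) (φ 7) = 1 ∧
      dist (φ 4) (φ 8) = 1 := by
  rintro ⟨φ, inj, h12, h24, h34, h35, h15, h13, h23, h56, h68, h78, h57, h67, h48⟩
  have ne : ∀ i j : ℕ, i ∈ Set.Icc 1 8 → j ∈ Set.Icc 1 8 → i ≠ j →
      ¬ (φ i 0 = φ j 0 ∧ φ i 1 = φ j 1) := by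
    intro i j hi hj hij h
    apply hij
    apply inj hi hj
    ext k
    fin_cases k
    · exact h.1
    · exact h.2
  have D : ∀ i j : ℕ, dist (φ i) (φ j) = 1 →
      (φ i 0 - φ j 0)^2 + (φ i 1 - φ j 1)^2 = 1 := by
    intro i j h
    have h2 : dist (φ i) (φ j) ^ 2 = 1 := by rw [h]; norm_num
    rw [EuclideanSpace.dist_sq_eq] at h2
    simpa [Fin.sum_univ_two, Real.dist_eq, sq_abs] using h2
  have S : ∀ i j : ℕ, dist (φ i) (φ j) = 1 → dist (φ j) (φ i) = 1 := by
    intro i j h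
    rwa [dist_comm]
  obtain ⟨x4, y4⟩ := rhombus_aux (D _ _ h12) (D _ _ h13) (D _ _ h23) (D _ _ (S _ _ h24))
    (D _ _ (S _ _ h34)) (ne 1 4 (by simp) (by simp) (by simp))
  obtain ⟨x5, y5⟩ := rhombus_aux (D _ _ (S _ _ h12)) (D _ _ h23) (D _ _ h13)
    (D _ _ (S _ _ h15)) (D _ _ (S _ _ h35)) (ne 2 5 (by simp) (by simp) (by simp))
  obtain ⟨x8, y8⟩ := rhombus_aux (D _ _ h56) (D _ _ h57) (D _ _ h67) (D _ _ (S _ _ h68))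
    (D _ _ (S _ _ h78)) (ne 5 8 (by simp) (by simp) (by simp))
  have X4 : φ 4 0 = 2 * φ 3 0 - φ 5 0 := by linarith
  have Y4 : φ 4 1 = 2 * φ 3 1 - φ 5 1 := by linarith
  have d48 := D _ _ h48
  rw [X4, Y4, x8, y8] at d48
  have d35 := D _ _ h35
  have d56 := D _ _ h56
  have d57 := D _ _ h57
  have d67 := D _ _ h67
  rcases final_aux (z := φ 5 0 - φ 3 0) (z' := φ 5 1 - φ 3 1) (a := φ 6 0 - φ 5 0)
    (a' := φ 6 1 - φ 5 1) (b := φ 7 0 - φ 5 0) (b' := φ 7 1 - φ 5 1)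
    (by linear_combination d35) (by linear_combination d56) (by linear_combination d57)
    (by linear_combination d67) (by linear_combination d48) with h | h
  · exact ne 3 6 (by simp) (by simp) (by simp) ⟨by linarith [h.1], by linarith [h.2]⟩
  · exact ne 3 7 (by simp) (by simp) (by simp) ⟨by linarith [h.1], by linarith [h.2]⟩
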